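/- Fix ε > 0. For n → ∞, set k = ⌊2 log₂ n⌋, m = n / (2k·ln(log₂ n)), and for each 0 ≤ i ≤ k−1 let δ_i = 0 if i ≤ log₂ m and δ_i = H⁻¹(1 − (log₂ m)/i) otherwise. Then the probability that the Erdős–Rényi random graph G(n, 1/2) contains a vertex subset S with |S| = k whose induced subgraph has at least Σ_{i=0}^{k−1} (1 − δ_i − ε)·i edges tends to 1 as n → ∞. -/

import Mathlib

open MeasureTheory Filter

/-- The Erdős–Rényi `G(n, 1/2)` measure: the uniform probability measure on
edge-indicator functions `Sym2 (Fin n) → Bool`. -/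
noncomputable def gnHalf (n : ℕ) : Measure (Sym2 (Fin n) → Bool) :=
  (PMF.uniformOfFintype (Sym2 (Fin n) → Bool)).toMeasure

open scoped Classical in
/-- Number of edges of the graph `g` with both endpoints in `S`. -/
noncomputable def edgeCount (n : ℕ) (g : Sym2 (Fin n) → Bool) (S : Finset (Fin n)) : ℕ :=
  (Finset.univ.filter fun e : Sym2 (Fin n) =>
    g e = true ∧ ¬ e.IsDiag ∧ ∀ v ∈ e, v ∈ S).card

/-- Edge density of the subgraph induced by `S`. -/
noncomputable def density (n : ℕ) (g : Sym2 (Fin n) → Bool) (S : Finset (Fin n)) : ℝ :=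
  (edgeCount n g S : ℝ) / (S.card.choose 2 : ℝ)

/-- Binary entropy function (base-2 logarithms). -/
noncomputable def binEnt (δ : ℝ) : ℝ :=
  -δ * Real.logb 2 δ - (1 - δ) * Real.logb 2 (1 - δ)

/-- Inverse of the binary entropy function restricted to `[0, 1/2]`. -/
noncomputable def binEntInv (y : ℝ) : ℝ :=
  sSup {x : ℝ | x ∈ Set.Icc (0 : ℝ) (1/2) ∧ binEnt x ≤ y}

/-- `k = ⌊2 log₂ n⌋`. -/
noncomputable def kVal (n : ℕ) : ℕ := ⌊2 * Real.logb 2 n⌋₊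

/-- `m = n / (2k · ln(log₂ n))`. -/
noncomputable def mVal (n : ℕ) : ℝ :=
  (n : ℝ) / (2 * (kVal n : ℝ) * Real.log (Real.logb 2 n))

/-- `δ_i = 0` for `i ≤ log₂ m`, and `δ_i = H⁻¹(1 − (log₂ m)/i)` otherwise. -/
noncomputable def deltaI (n i : ℕ) : ℝ :=
  if (i : ℝ) ≤ Real.logb 2 (mVal n) then 0
  else binEntInv (1 - Real.logb 2 (mVal n) / (i : ℝ))

section helpers
open Finset

lemma gibbs_term {a b : ℝ} (ha : 0 ≤ a) (hb : 0 < b) :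
    a * Real.log b ≤ a * Real.log a + 2 * (√a * √b - a) := by
  rcases ha.eq_or_lt with rfl | ha
  · simp
  have h := Real.log_le_sub_one_of_pos (x := √b / √a) (by positivity)
  rw [Real.log_div (by positivity) (by positivity), Real.log_sqrt hb.le, Real.log_sqrt ha.le] at h
  have h2 : a * (√b / √a) = √a * √b := by
    have : a = √a * √a := (Real.mul_self_sqrt ha.le).symm
    have hs : √a ≠ 0 := by positivity
    field_simp
    nlinarith
  nlinarith

lemma gibbs {d p : ℝ} (hd : 0 ≤ d) (hd1 : d ≤ 1) (hp : 0 < p) (hp1 : p < 1) :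
    d * Real.log p + (1 - d) * Real.log (1 - p) ≤
      d * Real.log d + (1 - d) * Real.log (1 - d) - (p - d) ^ 2 / 4 := by
  have h1 := gibbs_term hd hp
  have h2 := gibbs_term (a := 1 - d) (b := 1 - p) (by linarith) (by linarith)
  have e1 := Real.sq_sqrt hd
  have e2 := Real.sq_sqrt hp.le
  have e3 := Real.sq_sqrt (show 0 ≤ 1 - d by linarith)
  have e4 := Real.sq_sqrt (show 0 ≤ 1 - p by linarith)
  have b1 : √d ≤ 1 := Real.sqrt_le_one.2 hd1 
  have b2 : √p ≤ 1 := Real.sqrt_le_one.2 hp1.le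
  have n1 := Real.sqrt_nonneg d
  have n2 := Real.sqrt_nonneg p
  have key : (p - d) ^ 2 ≤ 4 * (√p - √d) ^ 2 := by
    have : p - d = (√p - √d) * (√p + √d) := by nlinarith
    rw [this, mul_pow]
    have : (√p + √d) ^ 2 ≤ 4 := by nlinarith
    nlinarith [sq_nonneg (√p - √d)]
  nlinarith [sq_nonneg (√(1-d) - √(1-p))]

lemma cheb {e : ℝ} (he : 0 < e) {i : ℕ} (hi : 1 ≤ 2 * e ^ 2 * i) {p : ℝ} (hp : 0 ≤ p) (hp1 : p ≤ 1) :
    1 / 2 ≤ ∑ l ∈ (range (i + 1)).filter (fun l : ℕ => (p - e) * i ≤ l ∧ (l : ℝ) ≤ (p + e) * i),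
      (i.choose l : ℝ) * (p ^ l * (1 - p) ^ (i - l)) := by
  have hi0 : 0 < i := by
    rcases Nat.eq_zero_or_pos i with rfl | h
    · norm_num at hi
    · exact h
  have hv := bernstein.variance hi0.ne' ⟨p, hp, hp1⟩
  have hs := bernstein.probability i ⟨p, hp, hp1⟩
  simp only [bernstein_apply, bernstein.z] at hv hs
  rw [Fin.sum_univ_eq_sum_range (fun l => (i.choose l : ℝ) * p ^ l * (1 - p) ^ (i - l)) (i+1)] at hs
  rw [Fin.sum_univ_eq_sum_range (fun l => (p - (l:ℝ)/i)^2 * ((i.choose l : ℝ) * p ^ l * (1 - p) ^ (i - l))) (i+1)] at hv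
  rw [← sum_filter_add_sum_filter_not _ (fun l : ℕ => (p - e) * i ≤ l ∧ (l : ℝ) ≤ (p + e) * i)] at hs
  have hI : (0:ℝ) < i := by exact_mod_cast hi0
  have hq : 0 ≤ 1 - p := by linarith
  have hb : e^2 * ∑ l ∈ (range (i + 1)).filter (fun l : ℕ => ¬ ((p - e) * i ≤ l ∧ (l : ℝ) ≤ (p + e) * i)),
      (i.choose l : ℝ) * p ^ l * (1 - p) ^ (i - l) ≤ p * (1 - p) / i := by
    rw [← hv, mul_sum]
    refine le_trans (sum_le_sum ?_) (sum_le_sum_of_subset_of_nonneg (filter_subset _ _) ?_)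
    · intro l hl
      have hl := (mem_filter.1 hl).2
      refine mul_le_mul_of_nonneg_right ?_ (by positivity)
      have hx : (l:ℝ) = (l / i) * i := by field_simp
      generalize (l:ℝ)/i = x at *
      rw [hx] at hl
      have : ¬ (p - e ≤ x ∧ x ≤ p + e) := fun h => hl ⟨by nlinarith, by nlinarith⟩
      by_cases h : p - e ≤ x
      · have : p + e < x := by by_contra h'; exact this ⟨h, by linarith⟩
        nlinarith
      · nlinarith
    · intros; positivity
  have hb2 : p * (1 - p) / i ≤ e^2 * (1/2) := by
    rw [div_le_iff₀ hI]
    nlinarith [sq_nonneg (p - 1/2)]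
  have := le_of_mul_le_mul_left (hb.trans hb2) (by positivity)
  simp only [← mul_assoc]
  linarith

noncomputable def cnt (i : ℕ) (x : ℝ) : ℝ :=
  ∑ l ∈ (range (i + 1)).filter (fun l : ℕ => (l : ℝ) ≤ x), (i.choose l : ℝ)

lemma tail_bound {e : ℝ} (he : 0 < e) : ∃ N : ℕ, ∀ i ≥ N, ∀ d : ℝ, 0 ≤ d → d ≤ 1/2 →
    Real.exp (i * (-d * Real.log d - (1 - d) * Real.log (1 - d))) ≤ cnt i ((d + 2 * e) * i) ∨
    2 ^ i / 2 ≤ cnt i ((d + 2 * e) * i) := by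
  obtain ⟨N, hN⟩ := exists_nat_ge (4 / e ^ 2)
  refine ⟨N, fun i hi d hd hd2 => ?_⟩
  have hi' : 4 ≤ e ^ 2 * i := by
    have : 4 / e^2 ≤ i := hN.trans (by exact_mod_cast hi)
    rw [div_le_iff₀ (by positivity)] at this
    linarith
  have main : ∀ p, 0 ≤ p → p ≤ 1/2 → p ≤ d + e → ∀ w : ℝ, 0 < w → (∀ l ≤ i, (p - e) * i ≤ l → p ^ l * (1 - p) ^ (i - l) ≤ w) →
      1/2 ≤ cnt i ((d + 2 * e) * i) * w := by
    intro p hp0 hp hpd w hw h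
    refine (cheb he (i := i) (by linarith) hp0 (by linarith)).trans ?_
    rw [cnt, sum_mul]
    refine (sum_le_sum (g := fun l => (i.choose l : ℝ) * w) ?_).trans (sum_le_sum_of_subset_of_nonneg ?_ ?_)
    · intro l hl
      simp only [mem_filter, mem_range] at hl
      exact mul_le_mul_of_nonneg_left (h l (by omega) hl.2.1) (by positivity)
    · intro l hl
      simp only [mem_filter, mem_range] at hl ⊢
      refine ⟨hl.1, hl.2.2.trans ?_⟩
      apply mul_le_mul_of_nonneg_right _ (by positivity)
      linarith
    · intros; positivity
  by_cases hc : 1/2 ≤ d + e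
  · right
    have := main (1/2) (by norm_num) le_rfl hc ((1/2)^i) (by positivity) (by
      intro l hl _
      rw [show (1 - 1/2 : ℝ) = 1/2 by norm_num, ← pow_add, Nat.add_sub_cancel' hl])
    rw [one_div, inv_pow, ← div_eq_mul_inv, le_div_iff₀ (by positivity)] at this
    linarith
  · left
    have hp : 0 < d + e := by linarith
    have hq : 0 < 1 - (d + e) := by linarith
    have := main (d + e) hp.le (by linarith) le_rfl
      (Real.exp (i * (d * Real.log (d+e) + (1 - d) * Real.log (1 - (d+e))))) (Real.exp_pos _) (by
      intro l hl hl2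
      have q1 : (d + e) ^ l = Real.exp (l * Real.log (d + e)) := by
        rw [Real.exp_nat_mul, Real.exp_log hp]
      have q2 : (1 - (d + e)) ^ (i - l) = Real.exp ((i - l : ℕ) * Real.log (1 - (d + e))) := by
        rw [Real.exp_nat_mul, Real.exp_log hq]
      rw [q1, q2, ← Real.exp_add]
      apply Real.exp_le_exp.2
      rw [Nat.cast_sub hl]
      have hlog : Real.log (d+e) ≤ Real.log (1 - (d+e)) := Real.log_le_log hp (by linarith)
      nlinarith)
    have hg := gibbs hd (by linarith) hp (by linarith)
    have hcn : 0 ≤ cnt i ((d + 2 * e) * i) := sum_nonneg (by intros; positivity)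
    have h2 := this.trans (mul_le_mul_of_nonneg_left (Real.exp_le_exp.2
      (mul_le_mul_of_nonneg_left hg (Nat.cast_nonneg i))) hcn)
    set h := (-d * Real.log d - (1 - d) * Real.log (1 - d)) with hh
    have e1 : (i:ℝ) * (d * Real.log d + (1 - d) * Real.log (1 - d) - (d + e - d) ^ 2 / 4) ≤ -(i*h) + -1 := by
      rw [hh]; nlinarith
    have h3 := h2.trans (mul_le_mul_of_nonneg_left (Real.exp_le_exp.2 e1) hcn)
    rw [Real.exp_add, Real.exp_neg, Real.exp_neg] at h3
    have e3 : (Real.exp 1)⁻¹ ≤ 1/2 := by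
      rw [one_div]; exact inv_anti₀ (by norm_num) (by linarith [Real.add_one_le_exp 1])
    have h4 : 1/2 ≤ cnt i ((d + 2 * e) * i) * ((Real.exp (i*h))⁻¹ * (1/2)) := 
      h3.trans (by gcongr)
    have : 1 ≤ cnt i ((d + 2 * e) * i) / (Real.exp (i*h)) := by rw [div_eq_mul_inv]; linarith
    rwa [le_div_iff₀ (Real.exp_pos _), one_mul] at this

section prob
open scoped Classical
variable {ι : Type*} [Fintype ι]

noncomputable def pr (p : (ι → Bool) → Prop) : ℝ :=
  ((univ.filter p).card : ℝ) / (Fintype.card (ι → Bool) : ℝ)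

lemma pr_eq (p : (ι → Bool) → Prop) [DecidablePred p] :
    pr p = ((univ.filter p).card : ℝ) / (Fintype.card (ι → Bool) : ℝ) := by
  unfold pr
  congr

lemma pr_zero {p : (ι → Bool) → Prop} (h : ∀ g, ¬ p g) : pr p = 0 := by
  unfold pr
  rw [filter_false_of_mem (fun g _ => h g)]; simp

lemma cardpos : (0:ℝ) < (Fintype.card (ι → Bool) : ℝ) := by
  exact_mod_cast Fintype.card_pos

lemma pr_mono {p q : (ι → Bool) → Prop} (h : ∀ g, p g → q g) : pr p ≤ pr q := by
  unfold pr
  gcongr with g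
  exact h g

lemma pr_nonneg (p : (ι → Bool) → Prop) : 0 ≤ pr p := by unfold pr; positivity

lemma pr_or_le (p q : (ι → Bool) → Prop) : pr (fun g => p g ∨ q g) ≤ pr p + pr q := by
  simp only [pr_eq]
  rw [← add_div]
  gcongr
  rw [filter_or]
  exact_mod_cast card_union_le _ _

lemma pr_true : pr (fun _ : ι → Bool => True) = 1 := by
  simp only [pr_eq]
  rw [filter_true, card_univ, div_self (cardpos (ι := ι)).ne']

lemma pr_le_one (p : (ι → Bool) → Prop) : pr p ≤ 1 :=
  (pr_mono (fun _ _ => trivial)).trans pr_true.le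

lemma pr_not (p : (ι → Bool) → Prop) : pr (fun g => ¬ p g) = 1 - pr p := by
  simp only [pr_eq]
  have h := card_filter_add_card_filter_not (s := (univ : Finset (ι → Bool))) p
  rw [card_univ] at h
  rw [eq_sub_iff_add_eq, ← add_div, div_eq_one_iff_eq (cardpos (ι := ι)).ne']
  rw [← h]; push_cast; ring

/-- independence of events on disjoint coordinates -/
lemma pr_indep (P : ι → Prop) (A B : (ι → Bool) → Prop)
    (hA : ∀ g h, (∀ e, P e → g e = h e) → A g → A h)
    (hB : ∀ g h, (∀ e, ¬ P e → g e = h e) → B g → B h) :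
    pr (fun g => A g ∧ B g) = pr A * pr B := by
  have key : ((univ.filter A) ×ˢ (univ.filter B)).card =
      ((univ.filter (fun g => A g ∧ B g)) ×ˢ (univ : Finset (ι → Bool))).card := by
    let f : (ι → Bool) × (ι → Bool) → (ι → Bool) × (ι → Bool) := fun x =>
      (fun e => if P e then x.1 e else x.2 e, fun e => if P e then x.2 e else x.1 e)
    have hf : ∀ x, f (f x) = x := by
      intro x
      ext e <;> by_cases h : P e <;> simp [f, h]
    refine card_bij' (fun x _ => f x) (fun x _ => f x) ?_ ?_ (fun x _ => hf x) (fun x _ => hf x)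
    · rintro ⟨g, h⟩ hx
      simp only [mem_product, mem_filter, mem_univ, true_and, and_true] at hx ⊢
      exact ⟨hA g _ (fun e he => by simp [f, he]) hx.1, hB h _ (fun e he => by simp [f, he]) hx.2⟩
    · rintro ⟨g, h⟩ hx
      simp only [mem_product, mem_filter, mem_univ, true_and, and_true] at hx ⊢
      exact ⟨hA g _ (fun e he => by simp [f, he]) hx.1, hB g _ (fun e he => by simp [f, he]) hx.2⟩
  rw [card_product, card_product, card_univ] at key
  simp only [pr_eq]
  have := (cardpos (ι := ι)).ne'
  field_simp
  exact_mod_cast key.symm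

/-- sum over a partition by the value of a function -/
lemma pr_fiber {β : Type*} [Fintype β] (c : (ι → Bool) → β) (A : (ι → Bool) → Prop) :
    pr A = ∑ b, pr (fun g => A g ∧ c g = b) := by
  simp only [pr_eq]
  rw [← sum_div]
  congr 1
  rw [card_eq_sum_card_fiberwise (f := c) (t := univ) (by simp)]
  push_cast
  refine sum_congr rfl fun b _ => ?_
  rw [filter_filter]

lemma pr_pattern (E F : Finset ι) (hF : F ⊆ E) :
    pr (fun g => E.filter (fun e => g e = true) = F) = 1 / 2 ^ E.card := by
  have h : (univ.filter (fun g : ι → Bool => E.filter (fun e => g e = true) = F)) =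
      Fintype.piFinset (fun e => if e ∈ E then {decide (e ∈ F)} else univ) := by
    ext g
    simp only [mem_filter, mem_univ, true_and, Fintype.mem_piFinset, Finset.ext_iff]
    refine forall_congr' fun e => ?_
    have := @hF e
    by_cases h1 : e ∈ E <;> by_cases h2 : e ∈ F <;> simp_all
  simp only [pr_eq]
  rw [h, Fintype.card_piFinset]
  have : ∀ e, (if e ∈ E then {decide (e ∈ F)} else univ : Finset Bool).card = if e ∈ E then 1 else 2 := by
    intro e; split_ifs <;> simp
  simp only [this]
  rw [Fintype.card_pi]
  have h2 : (∏ e : ι, if e ∈ E then 1 else 2) * 2 ^ E.card = ∏ e : ι, Fintype.card Bool := by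
    have h3 : 2 ^ E.card = ∏ e : ι, if e ∈ E then 2 else 1 := by
      rw [prod_ite_mem]; simp
    rw [h3, ← prod_mul_distrib]
    refine prod_congr rfl fun e _ => ?_
    split_ifs <;> simp
  rw [← h2]
  push_cast
  have : (∏ e : ι, if e ∈ E then (1:ℝ) else 2) ≠ 0 := prod_ne_zero_iff.2 (by intro e _; split_ifs <;> norm_num)
  field_simp

lemma pr_count (E : Finset ι) (t : ℝ) :
    pr (fun g => t ≤ ((E.filter (fun e => g e = true)).card : ℝ)) =
      (∑ l ∈ (range (E.card + 1)).filter (fun l : ℕ => t ≤ (l : ℝ)), (E.card.choose l : ℝ)) / 2 ^ E.card := by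
  rw [pr_fiber (fun g => E.filter (fun e => g e = true))]
  have h1 : ∀ b : Finset ι, pr (fun g : ι → Bool => t ≤ ((E.filter (fun e => g e = true)).card : ℝ) ∧
      E.filter (fun e => g e = true) = b) = if b ∈ E.powerset then (if t ≤ (b.card:ℝ) then 1 / 2 ^ E.card else 0) else 0 := by
    intro b
    split_ifs with hb ht
    · rw [← pr_pattern E b (mem_powerset.1 hb)]
      congr 1; ext g
      constructor
      · exact fun h => h.2
      · exact fun h => ⟨by rw [h]; exact ht, h⟩
    · apply pr_zero
      rintro g ⟨h1, h2⟩
      rw [h2] at h1; exact ht h1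
    · apply pr_zero
      rintro g ⟨h1, h2⟩
      exact hb (mem_powerset.2 (h2 ▸ filter_subset _ _))
  simp only [h1]
  rw [sum_ite_mem, univ_inter, sum_powerset, sum_filter, sum_div]
  refine sum_congr rfl fun l _ => ?_
  rw [sum_congr rfl (g := fun _ => if t ≤ (l:ℝ) then (1:ℝ) / 2 ^ E.card else 0), sum_const, card_powersetCard]
  · split_ifs <;> simp [div_eq_mul_inv]
  · intro b hb
    rw [(mem_powersetCard.1 hb).2]

end prob
section graph
open scoped Classical
variable {n : ℕ}

noncomputable def starEdges (v : Fin n) (S : Finset (Fin n)) : Finset (Sym2 (Fin n)) :=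
  S.image (fun u => s(v, u))

lemma star_card (v : Fin n) (S : Finset (Fin n)) : (starEdges v S).card = S.card :=
  card_image_of_injective _ (fun _ _ h => Sym2.congr_right.1 h)

lemma edgeCount_insert (g : Sym2 (Fin n) → Bool) {v : Fin n} {S : Finset (Fin n)} (hv : v ∉ S) :
    edgeCount n g S + ((starEdges v S).filter (fun e => g e = true)).card ≤ edgeCount n g (insert v S) := by
  unfold edgeCount
  rw [← card_union_of_disjoint]
  · apply card_le_card
    intro e he
    rw [mem_union] at he
    rcases he with he | he
    · simp only [mem_filter, mem_univ, true_and] at he ⊢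
      exact ⟨he.1, he.2.1, fun x hx => mem_insert_of_mem (he.2.2 x hx)⟩
    · simp only [mem_filter, starEdges, mem_image, mem_univ, true_and] at he ⊢
      obtain ⟨⟨u, hu, rfl⟩, hg⟩ := he
      refine ⟨hg, ?_, ?_⟩
      · rw [Sym2.mk_isDiag_iff]; rintro rfl; exact hv hu
      · intro x hx
        rcases Sym2.mem_iff.1 hx with rfl | rfl
        · exact mem_insert_self _ _
        · exact mem_insert_of_mem hu
  · rw [disjoint_left]
    intro e he he'
    simp only [mem_filter, starEdges, mem_image, mem_univ, true_and] at he he'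
    obtain ⟨⟨u, hu, rfl⟩, hg⟩ := he'
    exact hv (he.2.2 v (Sym2.mem_mk_left _ _))

lemma edgeCount_congr {g h : Sym2 (Fin n) → Bool} {S : Finset (Fin n)}
    (H : ∀ e : Sym2 (Fin n), (∀ x ∈ e, x ∈ S) → g e = h e) : edgeCount n g S = edgeCount n h S := by
  unfold edgeCount
  congr 1
  ext e
  simp only [mem_filter, mem_univ, true_and]
  constructor
  · rintro ⟨a, b, c⟩; exact ⟨(H e c) ▸ a, b, c⟩
  · rintro ⟨a, b, c⟩; exact ⟨(H e c).symm ▸ a, b, c⟩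

lemma starFilter_congr {g h : Sym2 (Fin n) → Bool} {v : Fin n} {S : Finset (Fin n)}
    (H : ∀ u ∈ S, g s(v, u) = h s(v, u)) :
    (starEdges v S).filter (fun e => g e = true) = (starEdges v S).filter (fun e => h e = true) := by
  apply filter_congr
  intro e he
  obtain ⟨u, hu, rfl⟩ := mem_image.1 he
  rw [H u hu]

lemma all_fail (S : Finset (Fin n)) (t r : ℝ) (hr1 : r ≤ 1)
    (hr : r ≤ (∑ l ∈ (range (S.card + 1)).filter (fun l : ℕ => t ≤ (l : ℝ)), (S.card.choose l : ℝ)) / 2 ^ S.card)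
    (W : Finset (Fin n)) (hW : Disjoint W S) :
    pr (fun g : Sym2 (Fin n) → Bool =>
      ∀ v ∈ W, ¬ t ≤ (((starEdges v S).filter (fun e => g e = true)).card : ℝ)) ≤ (1 - r) ^ W.card := by
  induction W using Finset.induction_on with
  | empty => simpa using pr_le_one _
  | insert v W hv ih =>
    rw [disjoint_insert_left] at hW
    rw [card_insert_of_notMem hv, pow_succ']
    have h1 : pr (fun g : Sym2 (Fin n) → Bool =>
        ¬ t ≤ (((starEdges v S).filter (fun e => g e = true)).card : ℝ)) ≤ 1 - r := by
      rw [pr_not, pr_count, star_card]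
      linarith
    have h2 := pr_indep (fun e : Sym2 (Fin n) => v ∈ e)
      (fun g => ¬ t ≤ (((starEdges v S).filter (fun e => g e = true)).card : ℝ))
      (fun g => ∀ v ∈ W, ¬ t ≤ (((starEdges v S).filter (fun e => g e = true)).card : ℝ))
      (by
        intro g h H hg
        rwa [← starFilter_congr (fun u _ => H _ (Sym2.mem_mk_left _ _))])
      (by
        intro g h H hg w hw
        rw [← starFilter_congr (g := g)]
        · exact hg w hw
        · intro u hu
          apply H
          intro hm
          rcases Sym2.mem_iff.1 hm with rfl | rfl
          · exact hv hw
          · exact hW.1 hu)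
    have h3 : pr (fun g : Sym2 (Fin n) → Bool =>
        ∀ w ∈ insert v W, ¬ t ≤ (((starEdges w S).filter (fun e => g e = true)).card : ℝ)) ≤
        pr (fun g : Sym2 (Fin n) → Bool => (¬ t ≤ (((starEdges v S).filter (fun e => g e = true)).card : ℝ)) ∧
      (∀ v ∈ W, ¬ t ≤ (((starEdges v S).filter (fun e => g e = true)).card : ℝ))) :=
      pr_mono (fun g hg => ⟨hg v (mem_insert_self _ _), fun w hw => hg w (mem_insert_of_mem hw)⟩)
    refine h3.trans ?_
    rw [h2]
    exact mul_le_mul h1 (ih hW.2) (pr_nonneg _) (by linarith)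

def valid (s : ℕ) (t : ℕ → ℝ) (j : ℕ) (g : Sym2 (Fin n) → Bool) (S : Finset (Fin n)) : Prop :=
  (∀ x ∈ S, x.val < j * s) ∧ S.card = j ∧ ∑ i ∈ range j, t i ≤ (edgeCount n g S : ℝ)

lemma valid_congr {s : ℕ} {t : ℕ → ℝ} {j : ℕ} {g h : Sym2 (Fin n) → Bool} {S : Finset (Fin n)}
    (H : ∀ e : Sym2 (Fin n), (∀ x ∈ e, x.val < j * s) → g e = h e) (hv : valid s t j g S) :
    valid s t j h S := by
  refine ⟨hv.1, hv.2.1, ?_⟩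
  rw [← edgeCount_congr (g := g)]
  · exact hv.2.2
  · exact fun e he => H e fun x hx => hv.1 x (he x hx)

lemma greedy (s k : ℕ) (hsk : k * s ≤ n) (t : ℕ → ℝ) (r : ℝ) (hr1 : r ≤ 1)
    (hr : ∀ j < k, r ≤ (∑ l ∈ (range (j + 1)).filter (fun l : ℕ => t j ≤ (l : ℝ)), (j.choose l : ℝ)) / 2 ^ j)
    (j : ℕ) (hj : j ≤ k) :
    pr (fun g : Sym2 (Fin n) → Bool => ¬ ∃ S, valid s t j g S) ≤ j * (1 - r) ^ s := by
  induction j with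
  | zero =>
    rw [pr_zero]; simp
    intro g hg
    exact hg ⟨∅, by simp [valid]⟩
  | succ j ih =>
    have ih := ih (by omega)
    let res : (Sym2 (Fin n) → Bool) → (Sym2 (Fin n) → Bool) := fun g e =>
      if (∀ x ∈ e, x.val < j * s) then g e else false
    have hres : ∀ g, ∀ e : Sym2 (Fin n), (∀ x ∈ e, x.val < j * s) → res g e = g e := by
      intro g e he
      simp only [res]; rw [if_pos he]
    let c : (Sym2 (Fin n) → Bool) → Finset (Fin n) := fun g =>
      if h : ∃ S, valid s t j (res g) S then h.choose else ∅
    have hc : ∀ g, (∃ S, valid s t j g S) → valid s t j g (c g) := by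
      rintro g ⟨S, hS⟩
      have h : ∃ S, valid s t j (res g) S := ⟨S, valid_congr (fun e he => (hres g e he).symm) hS⟩
      have := h.choose_spec
      simp only [c]; rw [dif_pos h]
      exact valid_congr (fun e he => (hres g e he)) this
    have hcc : ∀ g h, (∀ e : Sym2 (Fin n), (∀ x ∈ e, x.val < j * s) → g e = h e) → c g = c h := by
      intro g h H
      have : res g = res h := by
        ext e; simp only [res]; split_ifs with he
        · exact H e he
        · rfl
      simp only [c, this]
    let W : Finset (Fin n) := univ.filter (fun x => j * s ≤ x.val ∧ x.val < (j + 1) * s)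
    have hks : (j + 1) * s ≤ n := (Nat.mul_le_mul_right s hj).trans hsk
    have hWc : W.card = s := by
      have : W.map Fin.valEmbedding = Finset.Ico (j * s) ((j + 1) * s) := by
        ext x
        simp only [W, Finset.mem_map, mem_filter, mem_univ, true_and, mem_Ico, Fin.valEmbedding_apply]
        constructor
        · rintro ⟨a, ha, rfl⟩; exact ha
        · intro h; exact ⟨⟨x, by omega⟩, h, rfl⟩
      rw [← card_map Fin.valEmbedding, this, Nat.card_Ico, add_mul, one_mul]; omega
    have step : ∀ S : Finset (Fin n),
        pr (fun g : Sym2 (Fin n) → Bool => ((∃ S, valid s t j g S) ∧ ¬ ∃ S, valid s t (j+1) g S) ∧ c g = S) ≤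
        pr (fun g : Sym2 (Fin n) → Bool => (True ∧ c g = S)) * (1 - r) ^ s := by
      intro S
      by_cases hS : (∀ x ∈ S, x.val < j * s) ∧ S.card = j
      · have hd : Disjoint W S := by
          rw [disjoint_left]; intro x hx hx'
          have := (mem_filter.1 hx).2.1
          have := hS.1 x hx'
          omega
        have hf := all_fail S (t j) r hr1 (by rw [hS.2]; exact hr j (by omega)) W hd
        rw [hWc] at hf
        refine le_trans ?_ (mul_le_mul_of_nonneg_left hf (pr_nonneg _))
        rw [← pr_indep (fun e : Sym2 (Fin n) => ∀ x ∈ e, x.val < j * s)]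
        · apply pr_mono
          rintro g ⟨⟨h1, h2⟩, rfl⟩
          refine ⟨⟨trivial, rfl⟩, fun v hv ht => h2 ⟨insert v (c g), ?_⟩⟩
          have hval := hc g h1
          have hvn : v ∉ c g := fun h => disjoint_left.1 hd hv h
          refine ⟨?_, ?_, ?_⟩
          · intro x hx
            rcases mem_insert.1 hx with rfl | hx
            · exact (mem_filter.1 hv).2.2
            · have := hval.1 x hx
              rw [add_mul]; omega
          · rw [card_insert_of_notMem hvn, hval.2.1]
          · rw [sum_range_succ]
            have := edgeCount_insert g hvn
            have : (edgeCount n g (c g) : ℝ) + (((starEdges v (c g)).filter (fun e => g e = true)).card : ℝ) ≤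
              edgeCount n g (insert v (c g)) := by exact_mod_cast this
            linarith [hval.2.2]
        · rintro g h H ⟨_, h1⟩
          exact ⟨trivial, by rw [← h1]; exact (hcc g h H).symm⟩
        · intro g h H hg w hw
          rw [← starFilter_congr (g := g)]
          · exact hg w hw
          · intro u hu
            apply H
            intro hx
            have := hx w (Sym2.mem_mk_left _ _)
            have := (mem_filter.1 hw).2.1
            omega
      · rw [pr_zero]
        · exact mul_nonneg (pr_nonneg _) (pow_nonneg (by linarith) _)
        · rintro g ⟨⟨h1, h2⟩, rfl⟩
          exact hS ⟨(hc g h1).1, (hc g h1).2.1⟩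
    have tot : pr (fun g : Sym2 (Fin n) → Bool => (∃ S, valid s t j g S) ∧ ¬ ∃ S, valid s t (j+1) g S) ≤ (1 - r) ^ s := by
      rw [pr_fiber c]
      refine (sum_le_sum fun S _ => step S).trans ?_
      rw [← sum_mul, ← pr_fiber c (fun _ => True), pr_true, one_mul]
    have : pr (fun g : Sym2 (Fin n) → Bool => ¬ ∃ S, valid s t (j+1) g S) ≤ 
      pr (fun g : Sym2 (Fin n) → Bool => ¬ ∃ S, valid s t j g S) + 
      pr (fun g : Sym2 (Fin n) → Bool => (∃ S, valid s t j g S) ∧ ¬ ∃ S, valid s t (j+1) g S) := by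
      refine le_trans (pr_mono ?_) (pr_or_le _ _)
      intro g hg
      by_cases h : ∃ S, valid s t j g S
      · exact Or.inr ⟨h, hg⟩
      · exact Or.inl h
    push_cast
    linarith

lemma unif_aux {α : Type*} [MeasurableSpace α] [MeasurableSingletonClass α] [Nonempty α]
    (F1 F2 : Fintype α) (A : Set α) (D : DecidablePred (fun g => g ∈ A)) :
    (@PMF.uniformOfFintype α F1 _).toMeasure A =
      ENNReal.ofReal (((@univ α F2).filter (fun g => g ∈ A)).card / (@Fintype.card α F2 : ℝ)) := by
  obtain rfl : F1 = F2 := Subsingleton.elim _ _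
  rw [PMF.toMeasure_uniformOfFintype_apply A A.toFinite.measurableSet, ENNReal.ofReal_div_of_pos
    (by exact_mod_cast Fintype.card_pos), ENNReal.ofReal_natCast, ENNReal.ofReal_natCast]
  congr 2
  exact Fintype.card_of_subtype _ (by intro x; simp)

lemma gnHalf_eq (A : Set (Sym2 (Fin n) → Bool)) : gnHalf n A = ENNReal.ofReal (pr (fun g => g ∈ A)) :=
  unif_aux _ _ A _

end graph

lemma binEnt_eq (d : ℝ) :
    binEnt d * Real.log 2 = -d * Real.log d - (1 - d) * Real.log (1 - d) := by
  have : Real.log 2 ≠ 0 := (Real.log_pos (by norm_num)).ne'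
  unfold binEnt Real.logb
  field_simp

lemma binEnt_eq' (d : ℝ) : binEnt d = Real.binEntropy d / Real.log 2 := by
  have : Real.log 2 ≠ 0 := (Real.log_pos (by norm_num)).ne'
  rw [eq_div_iff this, binEnt_eq, Real.binEntropy, Real.log_inv, Real.log_inv]
  ring

lemma binEnt_cont : Continuous binEnt := by
  have : binEnt = fun d => Real.binEntropy d / Real.log 2 := funext binEnt_eq'
  rw [this]
  exact Real.binEntropy_continuous.div_const _

lemma binEntInv_spec {y : ℝ} (hy : 0 ≤ y) (hy1 : y < 1) :
    0 ≤ binEntInv y ∧ binEntInv y ≤ 1 / 2 ∧ y ≤ binEnt (binEntInv y) := by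
  set A := {x : ℝ | x ∈ Set.Icc (0 : ℝ) (1/2) ∧ binEnt x ≤ y} with hA
  have h0 : (0 : ℝ) ∈ A := ⟨⟨le_rfl, by norm_num⟩, by simpa [binEnt] using hy⟩
  have hbd : BddAbove A := ⟨1/2, fun x hx => hx.1.2⟩
  have hd : binEntInv y = sSup A := rfl
  have h1 : 0 ≤ sSup A := le_csSup hbd h0
  have h2 : sSup A ≤ 1/2 := csSup_le ⟨0, h0⟩ fun x hx => hx.1.2
  rw [hd]
  refine ⟨h1, h2, ?_⟩
  by_contra hlt
  push Not at hlt
  rcases h2.eq_or_lt with h | h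
  · have : binEnt (1/2) = 1 := by
      rw [binEnt_eq', one_div, Real.binEntropy_two_inv]
      exact div_self (Real.log_pos (by norm_num)).ne'
    rw [h, this] at hlt
    linarith
  · have e1 : ∀ᶠ x in nhds (sSup A), binEnt x < y :=
      binEnt_cont.continuousAt.eventually_lt continuousAt_const hlt
    have e2 : ∀ᶠ x in nhds (sSup A), x < 1/2 := eventually_lt_nhds h
    obtain ⟨b, hb, hb'⟩ := ((e1.and e2).filter_mono nhdsWithin_le_nhds |>.and
      (self_mem_nhdsWithin : ∀ᶠ x in nhdsWithin (sSup A) (Set.Ioi (sSup A)), x ∈ Set.Ioi (sSup A))).exists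
    have hb' : sSup A < b := hb'
    have : b ∈ A := ⟨⟨by linarith, by linarith [hb.2]⟩, hb.1.le⟩
    linarith [le_csSup hbd this]

lemma cnt_flip (i : ℕ) (x t : ℝ) (h : t + x = i) :
    cnt i x = ∑ l ∈ (range (i + 1)).filter (fun l : ℕ => t ≤ (l : ℝ)), (i.choose l : ℝ) := by
  unfold cnt
  refine sum_nbij' (fun l => i - l) (fun l => i - l) ?_ ?_ ?_ ?_ ?_
  · intro l hl
    simp only [mem_filter, mem_range] at hl ⊢
    refine ⟨by omega, ?_⟩
    rw [Nat.cast_sub (by omega)]; linarith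
  · intro l hl
    simp only [mem_filter, mem_range] at hl ⊢
    refine ⟨by omega, ?_⟩
    rw [Nat.cast_sub (by omega)]; linarith
  · intro l hl
    simp only [mem_filter, mem_range] at hl
    omega
  · intro l hl
    simp only [mem_filter, mem_range] at hl
    omega
  · intro l hl
    simp only [mem_filter, mem_range] at hl
    rw [Nat.choose_symm (by omega)]

lemma step_bound {ε : ℝ} (hε : 0 < ε) : ∃ C : ℝ, ∀ n : ℕ, C ≤ mVal n → 2 ≤ mVal n → ∀ i : ℕ,
    1 / mVal n ≤ (∑ l ∈ (range (i + 1)).filter (fun l : ℕ => (1 - deltaI n i - ε) * (i : ℝ) ≤ (l : ℝ)),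
      (i.choose l : ℝ)) / 2 ^ i := by
  obtain ⟨N, hN⟩ := tail_bound (e := ε / 2) (by positivity)
  refine ⟨2 ^ N, fun n hC h2 i => ?_⟩
  set m := mVal n with hm
  have hm0 : 0 < m := by linarith
  have hl2 : 0 < Real.log 2 := Real.log_pos (by norm_num)
  rw [le_div_iff₀ (by positivity), one_div, inv_mul_eq_div]
  unfold deltaI
  rw [← hm]
  split_ifs with hi
  · have h1 : (2:ℝ) ^ i ≤ m := by
      rw [Real.le_logb_iff_rpow_le (by norm_num) hm0] at hi
      simpa using hi
    have h3 : (2:ℝ) ^ i / m ≤ 1 := (div_le_one hm0).2 h1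
    refine h3.trans ?_
    have := single_le_sum (f := fun l : ℕ => (i.choose l : ℝ)) 
      (s := (range (i + 1)).filter (fun l : ℕ => (1 - 0 - ε) * (i : ℝ) ≤ (l : ℝ)))
      (fun _ _ => by positivity) (a := i) (by
        simp only [mem_filter, mem_range]
        refine ⟨by omega, ?_⟩
        have : (0:ℝ) ≤ i := by positivity
        nlinarith)
    simpa using this
  · push Not at hi
    have hlog1 : 0 < Real.logb 2 m := Real.logb_pos (by norm_num) (by linarith)
    have hi0 : (0:ℝ) < i := hlog1.trans hi
    have hiN : N ≤ i := by
      have : (N:ℝ) ≤ Real.logb 2 m := by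
        rw [Real.le_logb_iff_rpow_le (by norm_num) hm0]; simpa using hC
      exact_mod_cast (this.trans hi.le)
    have hq : Real.logb 2 m / i < 1 := (div_lt_one hi0).2 hi
    have hq0 : 0 < Real.logb 2 m / i := by positivity
    obtain ⟨d0, d1, hd⟩ := binEntInv_spec (y := 1 - Real.logb 2 m / i) (by linarith) (by linarith)
    set d := binEntInv (1 - Real.logb 2 m / i) with hdd
    rw [← cnt_flip i ((d + 2 * (ε / 2)) * i) ((1 - d - ε) * i) (by ring)]
    rcases hN i hiN d d0 d1 with h | h
    · refine le_trans ?_ h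
      rw [← binEnt_eq]
      have : (2:ℝ) ^ i / m = Real.exp (i * Real.log 2 - Real.log m) := by
        rw [Real.exp_sub, Real.exp_log hm0, Real.exp_nat_mul, Real.exp_log (by norm_num)]
      rw [this]
      apply Real.exp_le_exp.2
      have h5 : i * ((1 - Real.logb 2 m / i) * Real.log 2) = i * Real.log 2 - Real.log m := by
        unfold Real.logb
        field_simp
      rw [← h5]
      gcongr
    · refine le_trans ?_ h
      gcongr

lemma logb_tendsto : Tendsto (fun n : ℕ => Real.logb 2 n) atTop atTop :=
  (Real.tendsto_logb_atTop (by norm_num)).comp tendsto_natCast_atTop_atTop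

lemma mVal_tendsto : Tendsto mVal atTop atTop := by
  have h1 : Tendsto (fun n : ℕ => (Real.exp (Real.log n) / (Real.log n) ^ 2) * ((Real.log 2) ^ 2 / 4)) atTop atTop := by
    apply Tendsto.atTop_mul_const
    · have := Real.log_pos (show (1:ℝ) < 2 by norm_num)
      positivity
    · exact (Real.tendsto_exp_div_pow_atTop 2).comp
        (Real.tendsto_log_atTop.comp tendsto_natCast_atTop_atTop)
  refine tendsto_atTop_mono' _ ?_ h1
  filter_upwards [logb_tendsto.eventually_ge_atTop 3, eventually_gt_atTop 0] with n hx hn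
  have hn' : (0:ℝ) < n := by exact_mod_cast hn
  rw [Real.exp_log hn']
  have hl2 : 0 < Real.log 2 := Real.log_pos (by norm_num)
  have hlog : Real.log n = Real.logb 2 n * Real.log 2 := by
    unfold Real.logb; field_simp
  rw [hlog]
  unfold mVal
  set x := Real.logb 2 n with hxx
  have hL : 0 < Real.log x := Real.log_pos (by linarith)
  have hLx : Real.log x ≤ x := (Real.log_le_sub_one_of_pos (by linarith)).trans (by linarith)
  have hk : (kVal n : ℝ) ≤ 2 * x := Nat.floor_le (by positivity)
  have hk0 : 0 < (kVal n : ℝ) := by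
    have : 0 < kVal n := Nat.floor_pos.2 (by linarith)
    exact_mod_cast this
  have e : (n:ℝ) / (x * Real.log 2) ^ 2 * (Real.log 2 ^ 2 / 4) = n / (2 * (2 * x) * x) := by
    have : x ≠ 0 := by linarith
    field_simp
    norm_num
  rw [e]
  gcongr

lemma fail_bound {ε : ℝ} (hε : 0 < ε) : ∀ᶠ n : ℕ in atTop,
    1 - (2 * Real.exp 1) / Real.logb 2 n ≤ pr (fun g : Sym2 (Fin n) → Bool => g ∈ {g | ∃ S : Finset (Fin n),
          S.card = kVal n ∧
          (∑ i ∈ Finset.range (kVal n), (1 - deltaI n i - ε) * (i : ℝ)) ≤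
            (edgeCount n g S : ℝ)}) := by
  obtain ⟨C, hC⟩ := step_bound hε
  filter_upwards [logb_tendsto.eventually_ge_atTop 3, mVal_tendsto.eventually_ge_atTop C,
    mVal_tendsto.eventually_ge_atTop 2] with n hx h1 h2
  have hb := greedy (n := n) (n / kVal n) (kVal n) (Nat.mul_div_le _ _)
    (fun i => (1 - deltaI n i - ε) * (i : ℝ)) (1 / mVal n)
    ((div_le_one (by linarith)).2 (by linarith)) (fun j _ => hC n h1 h2 j) (kVal n) le_rfl
  rw [pr_not] at hb
  have hmono : pr (fun g : Sym2 (Fin n) → Bool => ∃ S, valid (n / kVal n)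
      (fun i => (1 - deltaI n i - ε) * (i : ℝ)) (kVal n) g S) ≤
      pr (fun g : Sym2 (Fin n) → Bool => g ∈ {g | ∃ S : Finset (Fin n),
          S.card = kVal n ∧
          (∑ i ∈ Finset.range (kVal n), (1 - deltaI n i - ε) * (i : ℝ)) ≤
            (edgeCount n g S : ℝ)}) :=
    pr_mono (fun g ⟨S, hS⟩ => ⟨S, hS.2.1, hS.2.2⟩)
  have hk : (kVal n : ℝ) ≤ 2 * Real.logb 2 n := Nat.floor_le (by positivity)
  have hk0 : 0 < (kVal n : ℝ) := by
    have : 0 < kVal n := Nat.floor_pos.2 (by linarith)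
    exact_mod_cast this
  have hL : 0 < Real.log (Real.logb 2 n) := Real.log_pos (by linarith)
  have hs : (n : ℝ) / kVal n - 1 ≤ ((n / kVal n : ℕ) : ℝ) := by
    rw [← Nat.floor_div_eq_div (K := ℝ)]
    exact (Nat.sub_one_lt_floor _).le
  have hmn : (n : ℝ) / kVal n = 2 * Real.log (Real.logb 2 n) * mVal n := by
    unfold mVal; field_simp
  have hpow : (1 - 1 / mVal n) ^ (n / kVal n) ≤ Real.exp 1 / (Real.logb 2 n) ^ 2 := by
    have a1 : 1 - 1 / mVal n ≤ Real.exp (-(1 / mVal n)) := by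
      linarith [Real.add_one_le_exp (-(1 / mVal n))]
    have a0 : 0 ≤ 1 - 1 / mVal n := by
      rw [sub_nonneg]; exact (div_le_one (by linarith)).2 (by linarith)
    refine (pow_le_pow_left₀ a0 a1 _).trans ?_
    rw [← Real.exp_nat_mul]
    have a2 : Real.exp 1 / (Real.logb 2 n) ^ 2 = Real.exp (1 - 2 * Real.log (Real.logb 2 n)) := by
      rw [Real.exp_sub, two_mul, Real.exp_add, Real.exp_log (by linarith), sq]
    rw [a2]
    apply Real.exp_le_exp.2
    set m := mVal n
    have hm0 : 0 < m := by linarith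
    have : 2 * Real.log (Real.logb 2 n) - 1 ≤ ((n / kVal n : ℕ) : ℝ) * (1 / m) := by
      rw [mul_one_div, le_div_iff₀ hm0]
      nlinarith
    linarith
  have hfin : (kVal n : ℝ) * (1 - 1 / mVal n) ^ (n / kVal n) ≤ (2 * Real.exp 1) / Real.logb 2 n := by
    calc (kVal n : ℝ) * (1 - 1 / mVal n) ^ (n / kVal n) 
        ≤ (2 * Real.logb 2 n) * (Real.exp 1 / (Real.logb 2 n) ^ 2) := by
          refine mul_le_mul hk hpow (pow_nonneg ?_ _) (by linarith)
          rw [sub_nonneg]; exact (div_le_one (by linarith)).2 (by linarith)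
      _ = _ := by
        have : Real.logb 2 n ≠ 0 := by linarith
        field_simp
  refine le_trans ?_ hmono
  linarith

end helpers

/-- Fix ε > 0. With `k = ⌊2 log₂ n⌋`, `m = n/(2k ln log₂ n)` and `δ_i` as above, the
probability that `G(n, 1/2)` contains a vertex subset `S` with `|S| = k` whose induced
subgraph has at least `Σ_{i=0}^{k−1} (1 − δ_i − ε)·i` edges tends to 1 as `n → ∞`. -/
theorem stmt4 (ε : ℝ) (hε : 0 < ε) :
    Tendsto (fun n : ℕ =>
        gnHalf n {g | ∃ S : Finset (Fin n),
          S.card = kVal n ∧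
          (∑ i ∈ Finset.range (kVal n), (1 - deltaI n i - ε) * (i : ℝ)) ≤
            (edgeCount n g S : ℝ)})
      atTop (nhds 1) := by
  simp only [gnHalf_eq]
  rw [← ENNReal.ofReal_one]
  apply ENNReal.tendsto_ofReal
  have h1 : Tendsto (fun n : ℕ => 1 - (2 * Real.exp 1) / Real.logb 2 n) atTop (nhds 1) := by
    simpa using (tendsto_const_nhds (x := (1:ℝ))).sub (logb_tendsto.const_div_atTop (2 * Real.exp 1))
  exact tendsto_of_tendsto_of_tendsto_of_le_of_le' h1 tendsto_const_nhds (fail_bound hε)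
    (Eventually.of_forall fun n => pr_le_one _)
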